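/- With notation as above (a family of multiplicative seminorms $\lambda_t$, $t \in [s,r]$, satisfying the Hadamard three-circles inequality), if $x$ satisfies $\lambda_t(x) = 0$ for all $t$ in some closed subinterval $[s', r'] \subseteq [s,r]$ with $s' < r'$, then $\lambda_t(x) = 0$ for all $t \in [s,r]$. -/

import Mathlib

/-- Given a family of multiplicative seminorms `Λ t`, `t ∈ [s,r]`, satisfying the
Hadamard three-circles inequality and depending continuously on `t`, if `Λ t x = 0`
for all `t` in some nondegenerate closed subinterval `[s', r'] ⊆ [s, r]`, then
`Λ t x = 0` for all `t ∈ [s, r]`. -/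
theorem stmt_11 {A : Type*} [CommRing A] (s r s' r' : ℝ)
    (hs : 0 < s) (hss' : s ≤ s') (hs'r' : s' < r') (hr'r : r' ≤ r)
    (Λ : ℝ → A → ℝ)
    (hnonneg : ∀ t ∈ Set.Icc s r, ∀ x : A, 0 ≤ Λ t x)
    (hSadd : ∀ t ∈ Set.Icc s r, ∀ x y : A, Λ t (x + y) ≤ max (Λ t x) (Λ t y))
    (hSmul : ∀ t ∈ Set.Icc s r, ∀ x y : A, Λ t (x * y) = Λ t x * Λ t y)
    (hcont : ∀ x : A, ContinuousOn (fun t => Λ t x) (Set.Icc s r))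
    (hadamard : ∀ t₁ ∈ Set.Icc s r, ∀ t₂ ∈ Set.Icc s r, ∀ c ∈ Set.Icc (0:ℝ) 1, ∀ x : A,
      Λ (t₁ ^ c * t₂ ^ (1 - c)) x ≤ Λ t₁ x ^ c * Λ t₂ x ^ (1 - c))
    (x : A) (hx : ∀ t ∈ Set.Icc s' r', Λ t x = 0) :
    ∀ t ∈ Set.Icc s r, Λ t x = 0 := by
  intro t ht
  have hs'0 : 0 < s' := hs.trans_le hss'
  have ht0 : 0 < t := hs.trans_le ht.1
  have hs'mem : s' ∈ Set.Icc s r := ⟨hss', hs'r'.le.trans hr'r⟩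
  have hr0 : 0 < r := ht0.trans_le ht.2
  set p : ℝ → ℝ := fun c => s' ^ c * t ^ (1 - c) with hp
  have hpmem : Set.MapsTo p (Set.Icc 0 1) (Set.Icc s r) := by
    intro c hc
    have hc' : 0 ≤ 1 - c := sub_nonneg.2 hc.2
    have key : ∀ u : ℝ, 0 < u → u ^ c * u ^ (1 - c) = u := fun u hu => by
      rw [← Real.rpow_add hu, add_sub_cancel, Real.rpow_one]
    constructor
    · calc s = s ^ c * s ^ (1 - c) := (key s hs).symm
        _ ≤ s' ^ c * t ^ (1 - c) :=
          mul_le_mul (Real.rpow_le_rpow hs.le hss' hc.1) (Real.rpow_le_rpow hs.le ht.1 hc')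
            (by positivity) (by positivity)
    · calc s' ^ c * t ^ (1 - c) ≤ r ^ c * r ^ (1 - c) :=
          mul_le_mul (Real.rpow_le_rpow hs'0.le hs'mem.2 hc.1)
            (Real.rpow_le_rpow ht0.le ht.2 hc') (by positivity) (by positivity)
        _ = r := key r hr0
  have hpcont : Continuous p :=
    (Real.continuous_const_rpow hs'0.ne').mul
      ((Real.continuous_const_rpow ht0.ne').comp (continuous_const.sub continuous_id))
  have hzero : ∀ c ∈ Set.Ioc (0 : ℝ) 1, Λ (p c) x = 0 := by
    intro c hc
    have hc' : c ∈ Set.Icc (0 : ℝ) 1 := Set.Ioc_subset_Icc_self hc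
    refine le_antisymm ?_ (hnonneg _ (hpmem hc') x)
    have h := hadamard s' hs'mem t ht c hc' x
    rwa [hx s' ⟨le_rfl, hs'r'.le⟩, Real.zero_rpow hc.1.ne', zero_mul] at h
  have hcomp : ContinuousOn (fun c => Λ (p c) x) (Set.Icc 0 1) :=
    (hcont x).comp hpcont.continuousOn hpmem
  have hclosure : Set.EqOn (fun c => Λ (p c) x) (fun _ => 0) (Set.Icc 0 1) :=
    Set.EqOn.of_subset_closure hzero hcomp continuousOn_const Set.Ioc_subset_Icc_self
      (closure_Ioc (zero_ne_one' ℝ)).ge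
  simpa [hp] using hclosure (Set.left_mem_Icc.2 zero_le_one)
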